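/- Let F be self-concordant on an open convex set D ⊆ E with ∇²F(x) positive definite for every x ∈ D. Let c ∈ E, t > 0, and set f_t(x) = t⟨c,x⟩ + F(x). Let A : E → ℝ^m be a linear map and b ∈ ℝ^m. Suppose x̄, x̂ ∈ D satisfy A x̂ = b, ‖x̂ − x̄‖_{x̄} ≤ β for some β ∈ (0,1), and tc + ∇F(x̄) + ∇²F(x̄)(x̂ − x̄) ∈ range A*. Then the constrained Newton decrement λ_{f_t}(x̂) := ( sup{ 2⟨tc + ∇F(x̂), h⟩ − ‖h‖²_{x̂} : h ∈ E, Ah = 0 } )^{1/2} satisfies λ_{f_t}(x̂) ≤ β²/(1 − β)². -/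

import Mathlib

open scoped RealInnerProductSpace

/-- The Hessian of `f` at `x`, as a linear operator on `E` (with respect to the inner product):
the Fréchet derivative of the gradient. -/
noncomputable def hessOp {E : Type*} [NormedAddCommGroup E] [InnerProductSpace ℝ E]
    [CompleteSpace E] (f : E → ℝ) (x : E) : E →L[ℝ] E :=
  fderiv ℝ (gradient f) x

/-- `f` is self-concordant on the open convex set `D`. -/
def SelfConcordantOn {E : Type*} [NormedAddCommGroup E] [InnerProductSpace ℝ E]
    (f : E → ℝ) (D : Set E) : Prop :=
  IsOpen D ∧ Convex ℝ D ∧ ContDiffOn ℝ 3 f D ∧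
    ∀ x ∈ D, ∀ h : E,
      iteratedFDeriv ℝ 3 f x (fun _ => h) ≤
        2 * (iteratedFDeriv ℝ 2 f x (fun _ => h)) ^ ((3 : ℝ) / 2)

/-- A decomposition of `h ⊗ h ⊗ u` into a convex combination of cubes, in coordinates: the three
nodes are obtained from `(C, R)` by rotations of angle `2π/3` for the form `C ^ 2 + 3 * R ^ 2`. -/
lemma cubic_polar_le {a b c d M C R : ℝ} (hCR : C ^ 2 + 3 * R ^ 2 = 1)
    (hp : ∀ x y : ℝ, x ^ 2 + 3 * y ^ 2 = 1 →
      a * x ^ 3 + 3 * b * x ^ 2 * y + 3 * c * x * y ^ 2 + d * y ^ 3 ≤ M) :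
    a * (C ^ 3 - 9 * C * R ^ 2) + b * (3 * C ^ 2 * R - 3 * R ^ 3) ≤ M := by
  have h0 := mul_le_mul_of_nonneg_left (hp C R hCR) (sq_nonneg (C ^ 2 - R ^ 2))
  have h1 := mul_le_mul_of_nonneg_left (hp ((-C - 3 * R) / 2) ((C - R) / 2)
    (by linear_combination hCR)) (sq_nonneg (((-C - 3 * R) / 2) ^ 2 - ((C - R) / 2) ^ 2))
  have h2 := mul_le_mul_of_nonneg_left (hp ((-C + 3 * R) / 2) ((-C - R) / 2)
    (by linear_combination hCR)) (sq_nonneg (((-C + 3 * R) / 2) ^ 2 - ((-C - R) / 2) ^ 2))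
  have hw : (C ^ 2 - R ^ 2) ^ 2 + (((-C - 3 * R) / 2) ^ 2 - ((C - R) / 2) ^ 2) ^ 2
      + (((-C + 3 * R) / 2) ^ 2 - ((-C - R) / 2) ^ 2) ^ 2 = (C ^ 2 + 3 * R ^ 2) ^ 2 := by ring
  rw [hCR] at hw
  have hid : (C ^ 2 + 3 * R ^ 2) ^ 2 *
      (a * (C ^ 3 - 9 * C * R ^ 2) + b * (3 * C ^ 2 * R - 3 * R ^ 3)) ≤
      ((C ^ 2 - R ^ 2) ^ 2 + (((-C - 3 * R) / 2) ^ 2 - ((C - R) / 2) ^ 2) ^ 2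
      + (((-C + 3 * R) / 2) ^ 2 - ((-C - R) / 2) ^ 2) ^ 2) * M := by
    linear_combination h0 + h1 + h2
  rw [hw, hCR] at hid
  linarith

/-- Trisection of a point of the unit circle. -/
lemma exists_trisection {x y : ℝ} (hxy : x ^ 2 + y ^ 2 = 1) :
    ∃ C R : ℝ, C ^ 2 + 3 * R ^ 2 = 1 ∧ x = C ^ 3 - 9 * C * R ^ 2 ∧
      y / √3 = 3 * C ^ 2 * R - 3 * R ^ 3 := by
  have hn : ‖(⟨x, y⟩ : ℂ)‖ = 1 := by
    rw [← sq_eq_sq₀ (norm_nonneg _) zero_le_one, Complex.sq_norm, Complex.normSq_mk]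
    linarith
  have h0 : (⟨x, y⟩ : ℂ) ≠ 0 := by
    intro h
    simp [h] at hn
  have hx := Complex.cos_arg h0
  have hy := Complex.sin_arg (⟨x, y⟩ : ℂ)
  rw [hn, div_one] at hx hy
  generalize Complex.arg ⟨x, y⟩ = α at hx hy
  simp only at hx hy
  have h3 : (√3) ^ 2 = 3 := Real.sq_sqrt (by norm_num)
  have h3' : √3 ≠ 0 := by positivity
  have hα : α = 3 * (α / 3) := by ring
  have hcs := Real.sin_sq_add_cos_sq (α / 3)
  rw [hα, Real.cos_three_mul] at hx
  rw [hα, Real.sin_three_mul] at hy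
  generalize Real.cos (α / 3) = C at *
  generalize Real.sin (α / 3) = S at *
  have hS : S = √3 * (S / √3) := by field_simp
  generalize S / √3 = R at hS
  refine ⟨C, R, ?_, ?_, ?_⟩
  · rw [hS] at hcs
    linear_combination hcs - R ^ 2 * h3
  · rw [hS] at hcs
    rw [← hx]
    linear_combination 3 * C * hcs - 3 * C * R ^ 2 * h3
  · rw [← hy, div_eq_iff h3', hS]
    rw [hS] at hcs
    linear_combination -3 * √3 * R * hcs - √3 * R ^ 3 * h3

section Trilinear

variable {E : Type*} [NormedAddCommGroup E] [NormedSpace ℝ E]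

lemma trilinear_polar_le_of_unit {T : E →L[ℝ] E →L[ℝ] E →L[ℝ] ℝ} {B : E →L[ℝ] E →L[ℝ] ℝ} {M : ℝ}
    (hT₁ : ∀ u v w, T u v w = T v u w) (hT₂ : ∀ u v w, T u v w = T u w v)
    (hB : ∀ u v, B u v = B v u) (hB₀ : ∀ u, u ≠ 0 → 0 < B u u)
    (hTB : ∀ h, B h h ≤ 1 → T h h h ≤ M) {u v : E} (hu : B u u = 1) (hv : B v v = 1) :
    T u u v ≤ M := by
  set x := B u v with hx
  set w := v - x • u with hw
  have hBw : B w w = 1 - x ^ 2 := by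
    simp only [hw, map_sub, map_smul, sub_apply,
      smul_apply, smul_eq_mul, hB v u, hu, hv, ← hx]
    ring
  have hBuw : B u w = 0 := by
    simp only [hw, map_sub, map_smul, smul_eq_mul, hu, ← hx]
    ring
  have hBw₀ : 0 ≤ B w w := by
    by_cases h : w = 0
    · simp [h]
    · exact (hB₀ w h).le
  set y := √(B w w) with hy
  have hy2 : y ^ 2 = B w w := Real.sq_sqrt hBw₀
  have h3 : (√3) ^ 2 = 3 := Real.sq_sqrt (by norm_num)
  have h3' : √3 ≠ 0 := by positivity
  set k := (√3 / y) • w with hk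
  have hvk : v = x • u + (y / √3) • k := by
    by_cases hy0 : y = 0
    · have : w = 0 := by
        by_contra h
        have := hB₀ w h
        rw [← hy2, hy0] at this
        simp at this
      rw [hy0, zero_div, zero_smul, add_zero]
      exact sub_eq_zero.1 this
    · rw [hk, smul_smul, show y / √3 * (√3 / y) = 1 by field_simp, one_smul, hw]
      abel
  have hBuk : B u k = 0 := by simp [hk, hBuw]
  have hBkk : B k k ≤ 3 := by
    by_cases hy0 : y = 0
    · simp [hk, hy0]
    · simp only [hk, map_smul, smul_apply, smul_eq_mul, ← hy2]
      apply le_of_eq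
      field_simp
      exact h3
  obtain ⟨C, R, hCR, hxC, hyR⟩ := exists_trisection (x := x) (y := y) (by rw [hy2, hBw]; ring)
  have key := cubic_polar_le (a := T u u u) (b := T u u k) (c := T u k k) (d := T k k k) (M := M)
    hCR (by
      intro p q hpq
      have h1 := hTB (p • u + q • k) (by
        simp only [map_add, map_smul, add_apply,
          smul_apply, smul_eq_mul, hB k u, hu, hBuk]
        nlinarith [sq_nonneg q])
      simp only [map_add, map_smul, add_apply,
          smul_apply, smul_eq_mul, hT₂ k k u, hT₁ k u, hT₂ u k u] at h1
      linear_combination h1)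
  rw [hvk, map_add, map_smul, map_smul, smul_eq_mul, smul_eq_mul, hyR, hxC]
  linear_combination key

/-- A symmetric trilinear form bounded by `2 ‖h‖ ^ 3` on the diagonal, for the norm of a
definite form `B`, is bounded by `2 ‖u‖ ^ 2 ‖v‖` at `(u, u, v)`. -/
lemma trilinear_polar_le {T : E →L[ℝ] E →L[ℝ] E →L[ℝ] ℝ} {B : E →L[ℝ] E →L[ℝ] ℝ}
    (hT₁ : ∀ u v w, T u v w = T v u w) (hT₂ : ∀ u v w, T u v w = T u w v)
    (hB : ∀ u v, B u v = B v u) (hB₀ : ∀ u, u ≠ 0 → 0 < B u u)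
    (hTB : ∀ h, T h h h ≤ 2 * (B h h) ^ ((3 : ℝ) / 2)) (u v : E) :
    T u u v ≤ 2 * B u u * √(B v v) := by
  by_cases hu : u = 0
  · simp [hu]
  by_cases hv : v = 0
  · simp [hv]
  have hBu := hB₀ u hu
  have hBv := hB₀ v hv
  have hsu := Real.sqrt_pos.2 hBu
  have hsv := Real.sqrt_pos.2 hBv
  have hBn : ∀ w : E, 0 < B w w → B ((√(B w w))⁻¹ • w) ((√(B w w))⁻¹ • w) = 1 := by
    intro w hw
    have := Real.sq_sqrt hw.le
    have h0 := (Real.sqrt_pos.2 hw).ne'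
    simp only [map_smul, smul_apply, smul_eq_mul]
    field_simp
    exact this.symm
  have h := trilinear_polar_le_of_unit (M := 2) hT₁ hT₂ hB hB₀ (by
    intro h hh
    refine (hTB h).trans ?_
    have h0 : 0 ≤ B h h := by
      by_cases h0 : h = 0
      · simp [h0]
      · exact (hB₀ h h0).le
    linarith [Real.rpow_le_one h0 hh (by norm_num : (0 : ℝ) ≤ 3 / 2)]) (hBn u hBu) (hBn v hBv)
  simp only [map_smul, smul_apply, smul_eq_mul] at h
  have h2 := Real.sq_sqrt hBu.le
  have h3 : T u u v / (√(B u u) ^ 2 * √(B v v)) ≤ 2 := by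
    refine le_of_eq_of_le ?_ h
    field_simp
  rw [div_le_iff₀ (by positivity), h2] at h3
  linarith

end Trilinear

section RealInequalities

lemma monotoneOn_Icc_of_hasDerivAt_nonneg {f f' : ℝ → ℝ} {a b : ℝ}
    (hf : ∀ s ∈ Set.Icc a b, HasDerivAt f (f' s) s) (hf' : ∀ s ∈ Set.Icc a b, 0 ≤ f' s) :
    MonotoneOn f (Set.Icc a b) :=
  monotoneOn_of_hasDerivWithinAt_nonneg (convex_Icc a b)
    (fun s hs => (hf s hs).continuousAt.continuousWithinAt)
    (fun s hs => (hf s (interior_subset hs)).hasDerivWithinAt)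
    (fun s hs => hf' s (interior_subset hs))

lemma one_sub_mul_pos {β s : ℝ} (hβ : β ∈ Set.Ioo (0 : ℝ) 1) (hs : s ∈ Set.Icc (0 : ℝ) 1) :
    0 < 1 - s * β := by
  nlinarith [hβ.1, hβ.2, hs.1, hs.2]

lemma sqrt_le_of_deriv_le {φ φ' : ℝ → ℝ} {β : ℝ} (hβ : β ∈ Set.Ioo (0 : ℝ) 1)
    (hφ : ∀ s ∈ Set.Icc (0 : ℝ) 1, HasDerivAt φ (φ' s) s)
    (hpos : ∀ s ∈ Set.Icc (0 : ℝ) 1, 0 < φ s)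
    (hφ' : ∀ s ∈ Set.Icc (0 : ℝ) 1, φ' s ≤ 2 * φ s * √(φ s)) (h0 : √(φ 0) ≤ β)
    {s : ℝ} (hs : s ∈ Set.Icc (0 : ℝ) 1) : √(φ s) ≤ β / (1 - s * β) := by
  have hmono : MonotoneOn (fun s => (√(φ s))⁻¹ + s) (Set.Icc (0 : ℝ) 1) := by
    refine monotoneOn_Icc_of_hasDerivAt_nonneg
      (f' := fun s => -(φ' s / (2 * √(φ s))) / √(φ s) ^ 2 + 1) (fun s hs => ?_) (fun s hs => ?_)
    · exact (((hφ s hs).sqrt (hpos s hs).ne').inv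
        (Real.sqrt_pos.2 (hpos s hs)).ne').add (hasDerivAt_id s)
    · have h1 := hφ' s hs
      have h2 := Real.sqrt_pos.2 (hpos s hs)
      have h3 := Real.sq_sqrt (hpos s hs).le
      have h4 : φ' s / (2 * √(φ s)) / √(φ s) ^ 2 ≤ 1 := by
        rw [div_div, div_le_one (by positivity), h3]
        linarith
      simp only [neg_div]
      linarith
  have h0s := hmono (Set.left_mem_Icc.2 zero_le_one) hs hs.1
  simp only [add_zero] at h0s
  have hp := one_sub_mul_pos hβ hs
  have hφ0 := Real.sqrt_pos.2 (hpos 0 (Set.left_mem_Icc.2 zero_le_one))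
  have hφs := Real.sqrt_pos.2 (hpos s hs)
  have hinv := inv_anti₀ hφ0 h0
  have hle : ((β / (1 - s * β)))⁻¹ ≤ (√(φ s))⁻¹ := by
    have : ((β / (1 - s * β)))⁻¹ = β⁻¹ - s := by
      have := hβ.1.ne'
      rw [inv_div]
      field_simp
    linarith
  exact (inv_le_inv₀ (div_pos hβ.1 hp) hφs).1 hle

lemma div_sq_le_of_le_deriv {ψ ψ' : ℝ → ℝ} {β : ℝ} (hβ : β ∈ Set.Ioo (0 : ℝ) 1)
    (hψ : ∀ s ∈ Set.Icc (0 : ℝ) 1, HasDerivAt ψ (ψ' s) s)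
    (hψ' : ∀ s ∈ Set.Icc (0 : ℝ) 1, -(2 * ψ s * (β / (1 - s * β))) ≤ ψ' s)
    {s : ℝ} (hs : s ∈ Set.Icc (0 : ℝ) 1) :
    ψ s / (1 - s * β) ^ 2 ≤ ψ 1 / (1 - β) ^ 2 := by
  have hmono : MonotoneOn (fun s => ψ s / (1 - s * β) ^ 2) (Set.Icc (0 : ℝ) 1) := by
    refine monotoneOn_Icc_of_hasDerivAt_nonneg
      (f' := fun s => (ψ' s * (1 - s * β) ^ 2 - ψ s * (2 * (1 - s * β) * (-β))) /
        ((1 - s * β) ^ 2) ^ 2) (fun s hs => ?_) (fun s hs => ?_)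
    · have hp := one_sub_mul_pos hβ hs
      have h1 : HasDerivAt (fun s : ℝ => 1 - s * β) (-β) s := by
        simpa using ((hasDerivAt_id s).mul_const β).const_sub 1
      have h2 : HasDerivAt (fun s : ℝ => (1 - s * β) ^ 2) (2 * (1 - s * β) * (-β)) s := by
        simpa using h1.fun_pow 2
      exact (hψ s hs).div h2 (by positivity)
    · have hp := one_sub_mul_pos hβ hs
      refine div_nonneg ?_ (by positivity)
      have h1 := mul_le_mul_of_nonneg_right (hψ' s hs) (sq_nonneg (1 - s * β))
      have h2 : -(2 * ψ s * (β / (1 - s * β))) * (1 - s * β) ^ 2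
          = -(2 * ψ s * β * (1 - s * β)) := by
        field_simp
      linarith
  simpa using hmono hs (Set.right_mem_Icc.2 zero_le_one) hs.2

lemma le_add_half_of_deriv_le {χ χ' χ'' : ℝ → ℝ} {K : ℝ}
    (hχ : ∀ s ∈ Set.Icc (0 : ℝ) 1, HasDerivAt χ (χ' s) s)
    (hχ' : ∀ s ∈ Set.Icc (0 : ℝ) 1, HasDerivAt χ' (χ'' s) s)
    (hK : ∀ s ∈ Set.Icc (0 : ℝ) 1, χ'' s ≤ K) :
    χ 1 ≤ χ 0 + χ' 0 + K / 2 := by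
  have h1 : MonotoneOn (fun s => K * s - χ' s) (Set.Icc (0 : ℝ) 1) :=
    monotoneOn_Icc_of_hasDerivAt_nonneg (f' := fun s => K - χ'' s)
      (fun s hs => by simpa using ((hasDerivAt_id s).const_mul K).fun_sub (hχ' s hs))
      (fun s hs => sub_nonneg.2 (hK s hs))
  have h2 : MonotoneOn (fun s => K / 2 * s ^ 2 + χ' 0 * s - χ s) (Set.Icc (0 : ℝ) 1) := by
    refine monotoneOn_Icc_of_hasDerivAt_nonneg (f' := fun s => K * s + χ' 0 - χ' s)
      (fun s hs => ?_) (fun s hs => ?_)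
    · refine HasDerivAt.sub ?_ (hχ s hs)
      refine HasDerivAt.add ?_ (by simpa using (hasDerivAt_id s).const_mul (χ' 0))
      exact ((hasDerivAt_pow 2 s).const_mul (K / 2)).congr_deriv (by push_cast; ring)
    · have := h1 (Set.left_mem_Icc.2 zero_le_one) hs hs.1
      simp only [mul_zero] at this
      linarith
  have := h2 (Set.left_mem_Icc.2 zero_le_one) (Set.right_mem_Icc.2 zero_le_one) zero_le_one
  simp only at this
  linarith

end RealInequalities

section SelfConcordant

variable {E : Type*} [NormedAddCommGroup E] [InnerProductSpace ℝ E]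

lemma inner_gradient_eq [CompleteSpace E] (f : E → ℝ) (x u : E) :
    ⟪gradient f x, u⟫ = fderiv ℝ f x u := by
  simp [gradient]

lemma inner_hessOp_eq [CompleteSpace E] (f : E → ℝ) (x u v : E) :
    ⟪hessOp f x u, v⟫ = fderiv ℝ (fderiv ℝ f) x u v := by
  have h : gradient f = (InnerProductSpace.toDual ℝ E).symm ∘ fderiv ℝ f := rfl
  rw [hessOp, h, LinearIsometryEquiv.comp_fderiv]
  exact InnerProductSpace.toDual_symm_apply

lemma SelfConcordantOn.contDiffAt [CompleteSpace E] {f : E → ℝ} {D : Set E} {x : E}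
    (hf : SelfConcordantOn f D) (hx : x ∈ D) : ContDiffAt ℝ 3 f x :=
  hf.2.2.1.contDiffAt (hf.1.mem_nhds hx)

lemma ContDiffAt.fderiv_fderiv_comm {f : E → ℝ} {x : E} (hf : ContDiffAt ℝ 2 f x) (u v : E) :
    fderiv ℝ (fderiv ℝ f) x u v = fderiv ℝ (fderiv ℝ f) x v u :=
  hf.isSymmSndFDerivAt (by simp) u v

lemma ContDiffAt.fderiv_fderiv_fderiv_comm_left {f : E → ℝ} {x : E} (hf : ContDiffAt ℝ 3 f x)
    (u v w : E) : fderiv ℝ (fderiv ℝ (fderiv ℝ f)) x u v w =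
      fderiv ℝ (fderiv ℝ (fderiv ℝ f)) x v u w := by
  have h : ContDiffAt ℝ 2 (fderiv ℝ f) x := hf.fderiv_right (by norm_num)
  rw [h.isSymmSndFDerivAt (by simp) u v]

lemma ContDiffAt.hasFDerivAt_fderiv_fderiv {f : E → ℝ} {x : E} (hf : ContDiffAt ℝ 3 f x) :
    HasFDerivAt (fderiv ℝ (fderiv ℝ f)) (fderiv ℝ (fderiv ℝ (fderiv ℝ f)) x) x := by
  have h : ContDiffAt ℝ 2 (fderiv ℝ f) x := hf.fderiv_right (by norm_num)
  have h' : ContDiffAt ℝ 1 (fderiv ℝ (fderiv ℝ f)) x := h.fderiv_right (by norm_num)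
  exact (h'.differentiableAt (by norm_num)).hasFDerivAt

lemma ContDiffAt.fderiv_fderiv_fderiv_comm_right {f : E → ℝ} {x : E} (hf : ContDiffAt ℝ 3 f x)
    (u v w : E) : fderiv ℝ (fderiv ℝ (fderiv ℝ f)) x u v w =
      fderiv ℝ (fderiv ℝ (fderiv ℝ f)) x u w v := by
  have hd := hf.hasFDerivAt_fderiv_fderiv
  have h1 := (hd.clm_apply (hasFDerivAt_const v x)).clm_apply (hasFDerivAt_const w x)
  have h2 := (hd.clm_apply (hasFDerivAt_const w x)).clm_apply (hasFDerivAt_const v x)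
  have heq : (fun y => fderiv ℝ (fderiv ℝ f) y v w) =ᶠ[nhds x]
      fun y => fderiv ℝ (fderiv ℝ f) y w v := by
    filter_upwards [(hf.of_le (by norm_num : (2 : WithTop ℕ∞) ≤ 3)).eventually (by simp)] with y hy
    exact hy.fderiv_fderiv_comm v w
  have := DFunLike.congr_fun (h1.unique (h2.congr_of_eventuallyEq heq)) u
  simpa using this

lemma iteratedFDeriv_three_diag (f : E → ℝ) (x h : E) :
    iteratedFDeriv ℝ 3 f x (fun _ => h) = fderiv ℝ (fderiv ℝ (fderiv ℝ f)) x h h h := by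
  rw [iteratedFDeriv_succ_apply_right, iteratedFDeriv_two_apply]
  rfl

lemma SelfConcordantOn.third_deriv_le [CompleteSpace E] {f : E → ℝ} {D : Set E} {x : E}
    (hf : SelfConcordantOn f D) (hx : x ∈ D)
    (hpos : ∀ u : E, u ≠ 0 → 0 < fderiv ℝ (fderiv ℝ f) x u u) (u v : E) :
    fderiv ℝ (fderiv ℝ (fderiv ℝ f)) x u u v ≤
      2 * fderiv ℝ (fderiv ℝ f) x u u * √(fderiv ℝ (fderiv ℝ f) x v v) := by
  have hc := hf.contDiffAt hx
  refine trilinear_polar_le hc.fderiv_fderiv_fderiv_comm_left hc.fderiv_fderiv_fderiv_comm_right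
    (hc.of_le (by norm_num)).fderiv_fderiv_comm hpos (fun h => ?_) u v
  have := hf.2.2.2 x hx h
  rwa [iteratedFDeriv_three_diag, iteratedFDeriv_two_apply] at this

/-- The error of the linearization of the gradient of a self-concordant function. -/
lemma SelfConcordantOn.fderiv_sub_linearization_le [CompleteSpace E] {f : E → ℝ} {D : Set E}
    (hf : SelfConcordantOn f D)
    (hpos : ∀ x ∈ D, ∀ u : E, u ≠ 0 → 0 < fderiv ℝ (fderiv ℝ f) x u u)
    {β : ℝ} (hβ : β ∈ Set.Ioo (0 : ℝ) 1) {x d : E} (hx : x ∈ D) (hxd : x + d ∈ D)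
    (hd : √(fderiv ℝ (fderiv ℝ f) x d d) ≤ β) (h : E) :
    fderiv ℝ f (x + d) h - fderiv ℝ f x h - fderiv ℝ (fderiv ℝ f) x d h ≤
      β ^ 2 / (1 - β) ^ 2 * √(fderiv ℝ (fderiv ℝ f) (x + d) h h) := by
  by_cases hd0 : d = 0
  · simp only [hd0, add_zero, sub_self, map_zero, zero_apply]
    positivity
  have hmem : ∀ s ∈ Set.Icc (0 : ℝ) 1, x + s • d ∈ D := fun s hs =>
    hf.2.1.add_smul_mem hx hxd hs
  have hline : ∀ s : ℝ, HasDerivAt (fun s : ℝ => x + s • d) d s := fun s => by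
    simpa using ((hasDerivAt_id s).smul_const d).const_add x
  have hder₂ : ∀ u v : E, ∀ s ∈ Set.Icc (0 : ℝ) 1,
      HasDerivAt (fun s : ℝ => fderiv ℝ (fderiv ℝ f) (x + s • d) u v)
        (fderiv ℝ (fderiv ℝ (fderiv ℝ f)) (x + s • d) d u v) s := fun u v s hs => by
    have h1 := (hf.contDiffAt (hmem s hs)).hasFDerivAt_fderiv_fderiv
    have h2 := (h1.clm_apply (hasFDerivAt_const u _)).clm_apply (hasFDerivAt_const v _)
    simpa [Function.comp_def] using h2.comp_hasDerivAt s (hline s)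
  have hder₁ : ∀ u : E, ∀ s ∈ Set.Icc (0 : ℝ) 1,
      HasDerivAt (fun s : ℝ => fderiv ℝ f (x + s • d) u)
        (fderiv ℝ (fderiv ℝ f) (x + s • d) d u) s := fun u s hs => by
    have h0 : ContDiffAt ℝ 2 (fderiv ℝ f) (x + s • d) :=
      (hf.contDiffAt (hmem s hs)).fderiv_right (by norm_num)
    have h1 := (h0.differentiableAt (by norm_num)).hasFDerivAt.comp_hasDerivAt s (hline s)
    simpa using h1.clm_apply (hasDerivAt_const s u)
  have hthird := fun s hs => hf.third_deriv_le (hmem s hs) (hpos _ (hmem s hs))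
  have hnonneg : ∀ s ∈ Set.Icc (0 : ℝ) 1, ∀ u, 0 ≤ fderiv ℝ (fderiv ℝ f) (x + s • d) u u := by
    intro s hs u
    by_cases hu : u = 0
    · simp [hu]
    · exact (hpos _ (hmem s hs) u hu).le
  have hφ : ∀ s ∈ Set.Icc (0 : ℝ) 1,
      √(fderiv ℝ (fderiv ℝ f) (x + s • d) d d) ≤ β / (1 - s * β) := fun s hs =>
    sqrt_le_of_deriv_le hβ (hder₂ d d) (fun s hs => hpos _ (hmem s hs) d hd0)
      (fun s hs => hthird s hs d d) (by simpa using hd) hs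
  have hψ : ∀ s ∈ Set.Icc (0 : ℝ) 1, fderiv ℝ (fderiv ℝ f) (x + s • d) h h / (1 - s * β) ^ 2 ≤
      fderiv ℝ (fderiv ℝ f) (x + (1 : ℝ) • d) h h / (1 - β) ^ 2 := fun s hs => by
    refine div_sq_le_of_le_deriv hβ (hder₂ h h) (fun s hs => ?_) hs
    have hc := hf.contDiffAt (hmem s hs)
    have h1 := hthird s hs h (-d)
    simp only [map_neg, neg_apply, neg_neg] at h1
    rw [hc.fderiv_fderiv_fderiv_comm_left d, hc.fderiv_fderiv_fderiv_comm_right h d]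
    have h2 := mul_le_mul_of_nonneg_left (hφ s hs)
      (mul_nonneg zero_le_two (hnonneg s hs h))
    linarith
  rw [one_smul] at hψ
  have hβ1 : 0 < 1 - β := sub_pos.2 hβ.2
  have hχ := le_add_half_of_deriv_le
    (χ := fun s => fderiv ℝ f (x + s • d) h - s * fderiv ℝ (fderiv ℝ f) x d h)
    (χ' := fun s => fderiv ℝ (fderiv ℝ f) (x + s • d) d h - fderiv ℝ (fderiv ℝ f) x d h)
    (χ'' := fun s => fderiv ℝ (fderiv ℝ (fderiv ℝ f)) (x + s • d) d d h)
    (K := 2 * (β ^ 2 / (1 - β) ^ 2 * √(fderiv ℝ (fderiv ℝ f) (x + d) h h)))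
    (fun s hs => (hder₁ h s hs).sub (by simpa using (hasDerivAt_id s).mul_const _))
    (fun s hs => (hder₂ d h s hs).sub_const _) (fun s hs => by
      have hp := one_sub_mul_pos hβ hs
      have hle : 1 - β ≤ 1 - s * β := by nlinarith [hβ.1, hs.2]
      have h1 : fderiv ℝ (fderiv ℝ f) (x + s • d) d d ≤ (β / (1 - s * β)) ^ 2 := by
        rw [← Real.sq_sqrt (hnonneg s hs d)]
        gcongr
        exact hφ s hs
      have h2 : √(fderiv ℝ (fderiv ℝ f) (x + s • d) h h) ≤
          (1 - s * β) / (1 - β) * √(fderiv ℝ (fderiv ℝ f) (x + d) h h) := by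
        have h3 := Real.sqrt_le_sqrt (hψ s hs)
        rw [Real.sqrt_div' _ (by positivity), Real.sqrt_div' _ (by positivity),
          Real.sqrt_sq hp.le, Real.sqrt_sq hβ1.le, div_le_iff₀ hp] at h3
        refine h3.trans_eq ?_
        ring
      calc fderiv ℝ (fderiv ℝ (fderiv ℝ f)) (x + s • d) d d h
          ≤ 2 * fderiv ℝ (fderiv ℝ f) (x + s • d) d d *
              √(fderiv ℝ (fderiv ℝ f) (x + s • d) h h) := hthird s hs d h
        _ ≤ 2 * (β / (1 - s * β)) ^ 2 *
              ((1 - s * β) / (1 - β) * √(fderiv ℝ (fderiv ℝ f) (x + d) h h)) := by gcongr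
        _ = 2 * (β ^ 2 / ((1 - s * β) * (1 - β)) * √(fderiv ℝ (fderiv ℝ f) (x + d) h h)) := by
          field_simp
        _ ≤ 2 * (β ^ 2 / ((1 - β) * (1 - β)) * √(fderiv ℝ (fderiv ℝ f) (x + d) h h)) := by gcongr
        _ = _ := by rw [← sq])
  simp only [one_smul, zero_smul, add_zero, one_mul, zero_mul, sub_zero, sub_self] at hχ
  linarith

end SelfConcordant

/-- Lemma 4.4 of the paper. If `F` is self-concordant on `D` with positive
definite Hessians, `x̂` is feasible (`A x̂ = b`), `‖x̂ - x̄‖_{x̄} ≤ β < 1`, and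
`t c + ∇F(x̄) + ∇²F(x̄)(x̂ - x̄) ∈ range A*`, then the constrained Newton decrement of
`f_t(x) = t⟨c,x⟩ + F(x)` at `x̂` is at most `β²/(1-β)²`. -/
theorem stmt2 {E : Type*} [NormedAddCommGroup E] [InnerProductSpace ℝ E]
    [FiniteDimensional ℝ E] {m : ℕ}
    (F : E → ℝ) (D : Set E) (hF : SelfConcordantOn F D)
    (hpos : ∀ x ∈ D, ∀ u : E, u ≠ 0 → 0 < ⟪hessOp F x u, u⟫)
    (c : E) (t : ℝ) (ht : 0 < t)
    (A : E →ₗ[ℝ] EuclideanSpace ℝ (Fin m)) (b : EuclideanSpace ℝ (Fin m))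
    (β : ℝ) (hβ : β ∈ Set.Ioo (0 : ℝ) 1)
    (xb xh : E) (hxb : xb ∈ D) (hxh : xh ∈ D)
    (hfeas : A xh = b)
    (hclose : Real.sqrt ⟪hessOp F xb (xh - xb), xh - xb⟫ ≤ β)
    (hrange : t • c + gradient F xb + hessOp F xb (xh - xb)
        ∈ Set.range (LinearMap.adjoint A)) :
    Real.sqrt (sSup {r : ℝ | ∃ h : E, A h = 0 ∧
        r = 2 * ⟪t • c + gradient F xh, h⟫ - ⟪hessOp F xh h, h⟫})
      ≤ β ^ 2 / (1 - β) ^ 2 := by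
  have hpos' : ∀ x ∈ D, ∀ u : E, u ≠ 0 → 0 < fderiv ℝ (fderiv ℝ F) x u u := fun x hx u hu => by
    rw [← inner_hessOp_eq]
    exact hpos x hx u hu
  have hK : 0 ≤ β ^ 2 / (1 - β) ^ 2 := by positivity
  refine Real.sqrt_le_iff.2 ⟨hK, csSup_le ⟨0, 0, by simp⟩ ?_⟩
  rintro r ⟨h, hAh, rfl⟩
  obtain ⟨y, hy⟩ := hrange
  have hzero : ⟪t • c + gradient F xb + hessOp F xb (xh - xb), h⟫ = 0 := by
    rw [← hy, LinearMap.adjoint_inner_left, hAh, inner_zero_right]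
  have hxd : xb + (xh - xb) = xh := add_sub_cancel _ _
  have key := hF.fderiv_sub_linearization_le hpos' hβ hxb (d := xh - xb) (by rwa [hxd])
    (by rwa [← inner_hessOp_eq]) h
  rw [hxd, ← inner_gradient_eq, ← inner_gradient_eq, ← inner_hessOp_eq, ← inner_hessOp_eq] at key
  simp only [inner_add_left] at hzero ⊢
  have hnonneg : 0 ≤ ⟪hessOp F xh h, h⟫ := by
    by_cases h0 : h = 0
    · simp [h0]
    · exact (hpos xh hxh h h0).le
  nlinarith [sq_nonneg (β ^ 2 / (1 - β) ^ 2 - √⟪hessOp F xh h, h⟫), Real.sq_sqrt hnonneg]
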